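/- Let p ≡ 3 (mod 4), let e = 2m with m ≥ 1, suppose s divides m and m/s ≡ 0 (mod 2), and let a ∈ F_q with a ≠ 0 and b ∈ F_p^*. If the equation X^{p^{2l}} + X = -a^{p^l} has no solution in F_q, then ψ_4^{(i)}(a, b) = 0 for i = 0, 1. If it has a solution γ in F_q, then for i = 0, 1: ψ_4^{(i)}(a, b) = -((p-1)/2) p^{e+m+s-3} if Tr(γ^{p^l+1}) = 0 or Tr(γ^{p^l+1}) ∈ C_0^{(2,p)}, and ψ_4^{(i)}(a, b) = ((p+1)/2) p^{e+m+s-3} if Tr(γ^{p^l+1}) ∈ C_1^{(2,p)}. -/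

import Mathlib

open scoped BigOperators

noncomputable section

/-- The primitive `p`-th root of unity `ζ_p = exp(2πi/p)`. -/
def zetaP (p : ℕ) : ℂ := Complex.exp (2 * Real.pi * Complex.I / p)

/-- The absolute trace map from `F_q = GF(p^e)` onto `F_p`. -/
def tr (p e : ℕ) [Fact p.Prime] (x : GaloisField p e) : ZMod p :=
  Algebra.trace (ZMod p) (GaloisField p e) x

/-- The Weil sum `S(α, β) = Σ_{x ∈ F_q} ζ_p^{Tr(α x^{p^l+1} + β x)}`. -/
def weilSum (p e l : ℕ) [Fact p.Prime] (α β : GaloisField p e) : ℂ :=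
  letI : Fintype (GaloisField p e) := Fintype.ofFinite _
  ∑ x : GaloisField p e, zetaP p ^ (tr p e (α * x ^ (p ^ l + 1) + β * x)).val

/- The quadratic character `η` of `F_p`, integer-valued:
`η(0) = 0`, `η(x) = 1` for nonzero squares, `η(x) = -1` for nonsquares. -/
open Classical in
def eta (p : ℕ) (x : ZMod p) : ℤ :=
  if x = 0 then 0 else if IsSquare x then 1 else -1

/- The cyclotomic classes of order 2 in `F_p^*`: `cyc p 0` is the set of nonzero
squares `C_0^{(2,p)}`, and `cyc p 1` is the set of nonsquares `C_1^{(2,p)}`. -/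
open Classical in
def cyc (p : ℕ) [Fact p.Prime] (i : ℕ) : Finset (ZMod p) :=
  Finset.univ.filter (fun x => x ≠ 0 ∧ (if i = 0 then IsSquare x else ¬ IsSquare x))

/-- `ψ_3(a) = ((p-1)/2) p^{e-3} Σ_{z1 ∈ F_p^*} ζ_p^{-z1} Σ_{z3 ∈ F_p^*} S(z1, a z3)`. -/
def psi3 (p e l : ℕ) [Fact p.Prime] (a : GaloisField p e) : ℂ :=
  ((p : ℂ) - 1) / 2 * (p : ℂ) ^ ((e : ℤ) - 3) *
    ∑ z1 ∈ ({0}ᶜ : Finset (ZMod p)), zetaP p ^ (-z1).val *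
      ∑ z3 ∈ ({0}ᶜ : Finset (ZMod p)),
        weilSum p e l (algebraMap (ZMod p) (GaloisField p e) z1)
          (a * algebraMap (ZMod p) (GaloisField p e) z3)

/-- `ψ_4^{(i)}(a, b) = p^{e-3} Σ_{c ∈ C_i} Σ_{z1 ∈ F_p^*} ζ_p^{-z1}
      Σ_{z2 ∈ F_p^*} ζ_p^{-c z2} S(z1, -a b⁻¹ z2)`, for `b ∈ F_p^*`. -/
def psi4 (p e l : ℕ) [Fact p.Prime] (i : ℕ) (a : GaloisField p e) (b : ZMod p) : ℂ :=
  (p : ℂ) ^ ((e : ℤ) - 3) *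
    ∑ c ∈ cyc p i, ∑ z1 ∈ ({0}ᶜ : Finset (ZMod p)), zetaP p ^ (-z1).val *
      ∑ z2 ∈ ({0}ᶜ : Finset (ZMod p)), zetaP p ^ (-(c * z2)).val *
        weilSum p e l (algebraMap (ZMod p) (GaloisField p e) z1)
          (-a * algebraMap (ZMod p) (GaloisField p e) (b⁻¹ * z2))

/-- `T_i(a,b) = |{(x1,x2) ∈ F_q² : Tr(x1^{p^l+1}) = 1, Tr(x2) ∈ C_i, Tr(a x1 + b x2) = 0}|`. -/
def Tcount (p e l : ℕ) [Fact p.Prime] (i : ℕ) (a b : GaloisField p e) : ℕ :=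
  Nat.card {x : GaloisField p e × GaloisField p e //
    tr p e (x.1 ^ (p ^ l + 1)) = 1 ∧ tr p e x.2 ∈ cyc p i ∧ tr p e (a * x.1 + b * x.2) = 0}

/-- The defining set `D_i = {(x1,x2) ∈ F_q² : Tr(x1^{p^l+1}) = 1, Tr(x2) ∈ C_i^{(2,p)}}`. -/
def Dset (p e l : ℕ) [Fact p.Prime] (i : ℕ) : Set (GaloisField p e × GaloisField p e) :=
  {x | tr p e (x.1 ^ (p ^ l + 1)) = 1 ∧ tr p e x.2 ∈ cyc p i}

/-- The codeword of `C_{D_i}` indexed by `(a, b) ∈ F_q²`: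
the vector `(Tr(a x1 + b x2))_{(x1,x2) ∈ D_i}`. -/
def codeword (p e l : ℕ) [Fact p.Prime] (i : ℕ) (a b : GaloisField p e) :
    Dset p e l i → ZMod p :=
  fun x => tr p e (a * x.1.1 + b * x.1.2)

/-- The linear code `C_{D_i} = {(Tr(a x1 + b x2))_{(x1,x2) ∈ D_i} : a, b ∈ F_q}`. -/
def code (p e l : ℕ) [Fact p.Prime] (i : ℕ) : Set (Dset p e l i → ZMod p) :=
  Set.range (fun ab : GaloisField p e × GaloisField p e => codeword p e l i ab.1 ab.2)

/-- The Hamming weight of a vector: the number of nonzero coordinates. -/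
def wt {ι : Type*} {p : ℕ} (c : ι → ZMod p) : ℕ := Nat.card {x : ι // c x ≠ 0}

section helpers

set_option linter.unusedSectionVars false

variable (p : ℕ) [Fact p.Prime] (K : Type*) [Field K] [Fintype K] [Algebra (ZMod p) K]

/-- The canonical additive character of `K`. -/
def chiK : AddChar K ℂ :=
  (ZMod.stdAddChar (N := p)).compAddMonoidHom (Algebra.trace (ZMod p) K).toAddMonoidHom

lemma chiK_apply (x : K) :
    chiK p K x = ZMod.stdAddChar (N := p) (Algebra.trace (ZMod p) K x) := rfl

lemma chiK_prim : (chiK p K).IsPrimitive := by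
  apply AddChar.IsPrimitive.of_ne_one
  intro h
  obtain ⟨x, hx⟩ := Algebra.trace_surjective (ZMod p) K 1
  have h1 : chiK p K x = 1 := by rw [h]; rfl
  rw [chiK_apply, hx, ← (ZMod.stdAddChar (N := p)).map_zero_eq_one,
    ZMod.injective_stdAddChar.eq_iff] at h1
  exact one_ne_zero h1

variable {K}

lemma trace_frob (l : ℕ) (x : K) :
    Algebra.trace (ZMod p) K (x ^ p ^ l) = Algebra.trace (ZMod p) K x := by
  induction l with
  | zero => simp
  | succ n ih =>
    rw [pow_succ, pow_mul]
    have := Algebra.trace_eq_of_algEquiv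
      (FiniteField.frobeniusAlgEquivOfAlgebraic (ZMod p) K) (x ^ p ^ n)
    rw [FiniteField.coe_frobeniusAlgEquivOfAlgebraic, ZMod.card] at this
    rw [← ih, ← this]

lemma charK : CharP K p := by
  have := charP_of_injective_algebraMap (algebraMap (ZMod p) K).injective p
  exact this

/-- The linearized polynomial. -/
def LL (l : ℕ) : K →ₗ[ZMod p] K where
  toFun x := x ^ p ^ (2 * l) + x
  map_add' x y := by
    have := charK p (K := K)
    rw [add_pow_char_pow]; ring
  map_smul' c x := by
    simp only [Algebra.smul_def, mul_pow, RingHom.id_apply]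
    rw [← map_pow, ZMod.pow_card_pow]; ring

lemma LL_apply (l : ℕ) (x : K) : LL p l x = x ^ p ^ (2 * l) + x := rfl

lemma trace_cross (l : ℕ) (x w : K) :
    Algebra.trace (ZMod p) K (x * w ^ p ^ l + x ^ p ^ l * w) =
      Algebra.trace (ZMod p) K (x ^ p ^ l * LL p l w) := by
  rw [LL_apply, map_add, ← trace_frob p l (x * w ^ p ^ l), ← map_add]
  congr 1
  rw [mul_pow, ← pow_mul, ← pow_add, two_mul]; ring

lemma trace_quad (l : ℕ) (x w : K) :
    Algebra.trace (ZMod p) K ((x + w) ^ (p ^ l + 1)) =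
      Algebra.trace (ZMod p) K (x ^ (p ^ l + 1)) + Algebra.trace (ZMod p) K (w ^ (p ^ l + 1)) +
      Algebra.trace (ZMod p) K (x ^ p ^ l * LL p l w) := by
  have := charK p (K := K)
  rw [← trace_cross, ← map_add, ← map_add]
  congr 1
  rw [pow_succ, add_pow_char_pow]; ring

/-- Weil sum, in terms of the standard character. -/
def wS (l : ℕ) (z : ZMod p) (β : K) : ℂ :=
  ∑ x : K, ZMod.stdAddChar (N := p)
    (z * Algebra.trace (ZMod p) K (x ^ (p ^ l + 1)) + Algebra.trace (ZMod p) K (β * x))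

lemma trace_zmul (z : ZMod p) (x : K) :
    Algebra.trace (ZMod p) K (algebraMap (ZMod p) K z * x) = z * Algebra.trace (ZMod p) K x := by
  rw [← Algebra.smul_def, map_smul, smul_eq_mul]

/-- Completing the square. -/
lemma wS_shift (l : ℕ) (z c : ZMod p) (a γ : K) (h : LL p l γ = -a ^ p ^ l) :
    wS p l z (-a * algebraMap (ZMod p) K (z * c)) =
      ZMod.stdAddChar (N := p) (-(z * c ^ 2 * Algebra.trace (ZMod p) K (γ ^ (p ^ l + 1)))) *
        wS p l z (0 : K) := by
  have h2 : wS p l z (0 : K) =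
      ZMod.stdAddChar (N := p) (z * c ^ 2 * Algebra.trace (ZMod p) K (γ ^ (p ^ l + 1))) *
      wS p l z (-a * algebraMap (ZMod p) K (z * c)) := by
    unfold wS
    rw [← Equiv.sum_comp (Equiv.addRight (c • γ)), Finset.mul_sum]
    refine Finset.sum_congr rfl fun x _ => ?_
    rw [← AddChar.map_add_eq_mul]
    congr 1
    simp only [Equiv.coe_addRight, zero_mul, map_zero, add_zero]
    rw [trace_quad, map_smul, h]
    have e1 : x ^ p ^ l * c • -a ^ p ^ l = algebraMap (ZMod p) K (-c) * ((a * x) ^ p ^ l) := by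
      rw [Algebra.smul_def, mul_pow, map_neg]; ring
    have e2 : (c • γ) ^ (p ^ l + 1) = algebraMap (ZMod p) K (c ^ 2) * γ ^ (p ^ l + 1) := by
      rw [Algebra.smul_def, mul_pow, ← map_pow, pow_succ c, ZMod.pow_card_pow, ← sq]
    have e3 : -a * algebraMap (ZMod p) K (z * c) * x
        = algebraMap (ZMod p) K (- (z * c)) * (a * x) := by
      rw [map_neg]; ring
    rw [e1, e2, e3, trace_zmul, trace_zmul, trace_zmul, trace_frob]
    ring
  rw [h2, ← mul_assoc, ← AddChar.map_add_eq_mul]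
  simp

lemma trace_rad (l : ℕ) (hp2 : p ≠ 2) (w : K) (hw : LL p l w = 0) :
    Algebra.trace (ZMod p) K (w ^ (p ^ l + 1)) = 0 := by
  have h1 : (w ^ (p ^ l + 1)) ^ p ^ l = - w ^ (p ^ l + 1) := by
    rw [LL_apply] at hw
    have : w ^ p ^ (2 * l) = - w := by linear_combination hw
    rw [← pow_mul, add_mul, ← pow_add, ← two_mul, one_mul, pow_add, this, pow_succ]; ring
  have h2 := trace_frob p l (w ^ (p ^ l + 1))
  rw [h1, map_neg] at h2
  have h3 : (2 : ZMod p) * Algebra.trace (ZMod p) K (w ^ (p ^ l + 1)) = 0 := by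
    linear_combination -h2
  rcases mul_eq_zero.1 h3 with h | h
  · exfalso
    have : Fact (2 < p) := ⟨lt_of_le_of_ne (Fact.out : p.Prime).two_le (Ne.symm hp2)⟩
    have h2' : ((2 : ℕ) : ZMod p) = 0 := by exact_mod_cast h
    rw [ZMod.natCast_eq_zero_iff] at h2'
    have := Nat.le_of_dvd (by norm_num) h2'
    have : 2 < p := Fact.out
    omega
  · exact h

lemma wS_zero (l : ℕ) (z c : ZMod p) (a w : K) (hw : LL p l w = 0) (hz : z * c ≠ 0)
    (hp2 : p ≠ 2)
    (haw : Algebra.trace (ZMod p) K (a * w) ≠ 0) :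
    wS p l z (-a * algebraMap (ZMod p) K (z * c)) = 0 := by
  have h2 : wS p l z (-a * algebraMap (ZMod p) K (z * c)) =
      ZMod.stdAddChar (N := p) (-(z * c) * Algebra.trace (ZMod p) K (a * w)) *
      wS p l z (-a * algebraMap (ZMod p) K (z * c)) := by
    conv_lhs => unfold wS
    conv_rhs => unfold wS
    rw [Finset.mul_sum]
    conv_lhs => rw [← Equiv.sum_comp (Equiv.addRight w)]
    refine Finset.sum_congr rfl fun x _ => ?_
    rw [← AddChar.map_add_eq_mul]
    congr 1
    simp only [Equiv.coe_addRight]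
    rw [trace_quad, hw, trace_rad p l hp2 w hw, ← trace_zmul, mul_zero, map_zero, mul_add (-a * _),
      map_add (Algebra.trace (ZMod p) K), map_neg]
    have : -algebraMap (ZMod p) K (z * c) * (a * w) = -a * algebraMap (ZMod p) K (z * c) * w := by
      ring
    rw [this]; ring
  have h3 : ZMod.stdAddChar (N := p) (-(z * c) * Algebra.trace (ZMod p) K (a * w)) ≠ 1 := by
    rw [← (ZMod.stdAddChar (N := p)).map_zero_eq_one, ZMod.injective_stdAddChar.ne_iff]
    exact mul_ne_zero (neg_ne_zero.2 hz) haw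
  by_contra h4
  exact h3 (mul_right_cancel₀ h4 (by rw [one_mul]; exact h2.symm))

lemma exists_rad (l : ℕ) (a : K) (h : ¬ ∃ x : K, LL p l x = -a ^ p ^ l) :
    ∃ w : K, LL p l w = 0 ∧ Algebra.trace (ZMod p) K (a * w) ≠ 0 := by
  have h1 : -a ^ p ^ l ∉ LinearMap.range (LL p l : K →ₗ[ZMod p] K) := by
    rintro ⟨x, hx⟩; exact h ⟨x, hx⟩
  obtain ⟨f, hf, hle⟩ := Submodule.exists_le_ker_of_notMem h1
  have hnd := traceForm_nondegenerate (ZMod p) K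
  obtain ⟨y, hy⟩ : ∃ y : K, ∀ x, f x = Algebra.trace (ZMod p) K (y * x) := by
    refine ⟨(LinearMap.BilinForm.toDual _ hnd).symm f, fun x => ?_⟩
    have := LinearMap.BilinForm.apply_toDual_symm_apply (hB := hnd) f x
    rw [← this]; rfl
  -- surjectivity of Frobenius powers
  have hs : ∀ (n : ℕ) (x : K), ∃ v : K, v ^ p ^ n = x := by
    intro n x
    have := charK p (K := K)
    obtain ⟨v, hv⟩ := (iterateFrobeniusEquiv K p n).surjective x
    exact ⟨v, by simpa [iterateFrobeniusEquiv_apply, iterateFrobenius_def] using hv⟩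
  obtain ⟨w, hw⟩ := hs l y
  obtain ⟨u, hu⟩ := hs (2 * l) y
  have hLu : LL p l u = 0 := by
    apply (traceForm_nondegenerate (ZMod p) K).1
    intro x
    rw [Algebra.traceForm_apply]
    have h5 : f (LL p l x) = 0 := hle ⟨x, rfl⟩
    rw [hy, LL_apply, ← hu, mul_add, map_add, ← mul_pow, trace_frob, ← map_add] at h5
    rw [LL_apply, ← h5]; congr 1; ring
  have hyu : y = -u := by
    rw [LL_apply, hu] at hLu; linear_combination hLu
  have hLy : LL p l y = 0 := by rw [hyu, map_neg, hLu, neg_zero]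
  refine ⟨w, ?_, ?_⟩
  · have : (LL p l w) ^ p ^ l = 0 := by
      have := charK p (K := K)
      rw [LL_apply, add_pow_char_pow, ← pow_mul, mul_comm, pow_mul, hw]
      exact hLy
    exact pow_eq_zero_iff (pow_ne_zero _ (Fact.out : p.Prime).ne_zero) |>.1 this
  · rw [hy] at hf
    rw [← trace_frob p l, mul_pow, hw]
    intro h6
    apply hf
    rw [mul_neg, map_neg, mul_comm, h6, neg_zero]

lemma gcd_rad (s j k : ℕ) (hj : Nat.Coprime j (4 * k)) :
    Nat.gcd (p ^ (4 * k * s) - 1) (p ^ (2 * (s * j)) - 1) = p ^ (2 * s) - 1 := by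
  rw [Nat.pow_sub_one_gcd_pow_sub_one]
  congr 2
  have h1 : 4 * k * s = (2 * s) * (2 * k) := by ring
  have h2 : 2 * (s * j) = (2 * s) * j := by ring
  have h3 : Nat.Coprime j (2 * k) := Nat.Coprime.coprime_dvd_right ⟨2, by ring⟩ hj
  rw [h1, h2, Nat.gcd_mul_left, h3.symm.gcd_eq_one, mul_one]

lemma gcd_quad (s j k : ℕ) (hj : Nat.Coprime j (4 * k)) :
    Nat.gcd (p ^ (4 * k * s) - 1) (p ^ (s * j) + 1) = p ^ s + 1 := by
  have hodd : Odd j := by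
    rw [← Nat.not_even_iff_odd]
    intro h
    have h2 : 2 ∣ Nat.gcd j (4 * k) := Nat.dvd_gcd h.two_dvd ⟨2 * k, by ring⟩
    rw [hj.gcd_eq_one] at h2
    omega
  have hf : ∀ x : ℕ, (p ^ x - 1) * (p ^ x + 1) = p ^ (2 * x) - 1 := by
    intro x
    have : p ^ (2 * x) = p ^ x * p ^ x := by rw [two_mul, pow_add]
    have h := Nat.mul_self_sub_mul_self_eq (p ^ x) 1
    rw [one_mul] at h
    rw [this, h, mul_comm]
  apply Nat.dvd_antisymm
  · obtain ⟨t, rfl⟩ := hodd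
    set d := Nat.gcd (p ^ (4 * k * s) - 1) (p ^ (s * (2 * t + 1)) + 1)
    have h1 : d ∣ p ^ (2 * s) - 1 := by
      rw [← gcd_rad p s (2 * t + 1) k hj]
      refine Nat.dvd_gcd (Nat.gcd_dvd_left _ _) ((Nat.gcd_dvd_right _ _).trans ?_)
      rw [← hf]; exact Dvd.intro_left _ rfl
    have h2 : d ∣ p ^ (s * (2 * t + 1)) + 1 := Nat.gcd_dvd_right _ _
    have h3 : d ∣ p ^ (2 * s * t) - 1 := h1.trans (by
      rw [pow_mul p (2 * s)]; exact Nat.sub_one_dvd_pow_sub_one _ _)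
    have h4 : p ^ (s * (2 * t + 1)) + 1 = p ^ s * (p ^ (2 * s * t) - 1) + (p ^ s + 1) := by
      have h5 : p ^ (s * (2 * t + 1)) = p ^ s * p ^ (2 * s * t) := by rw [← pow_add]; ring_nf
      have h6 : 1 ≤ p ^ (2 * s * t) := Nat.one_le_pow _ _ (Fact.out : p.Prime).pos
      obtain ⟨r, hr⟩ := Nat.exists_eq_add_of_le h6
      rw [h5, hr, Nat.add_sub_cancel_left]; ring
    rw [h4] at h2
    exact (Nat.dvd_add_right (Dvd.dvd.mul_left h3 _)).1 h2
  · refine Nat.dvd_gcd ?_ ?_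
    · have h1 : p ^ (2 * s) - 1 ∣ p ^ (4 * k * s) - 1 := by
        rw [show 4 * k * s = 2 * s * (2 * k) by ring, pow_mul p (2 * s)]
        exact Nat.sub_one_dvd_pow_sub_one _ _
      refine Dvd.dvd.trans ?_ h1
      rw [← hf]; exact Dvd.intro_left _ rfl
    · have := hodd.nat_add_dvd_pow_add_pow (p ^ s) 1
      rwa [one_pow, ← pow_mul] at this

lemma exists_root {G : Type*} [CommGroup G] [IsCyclic G] [Finite G] (n : ℕ) (y : G)
    (h : y ^ (Nat.card G / (Nat.card G).gcd n) = 1) : ∃ x : G, x ^ n = y := by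
  have hle : (powMonoidHom n : G →* G).range ≤
      (powMonoidHom (Nat.card G / (Nat.card G).gcd n) : G →* G).ker := by
    rintro _ ⟨x, rfl⟩
    rw [MonoidHom.mem_ker, powMonoidHom_apply, powMonoidHom_apply, ← pow_mul]
    have : Nat.card G ∣ n * (Nat.card G / (Nat.card G).gcd n) := by
      obtain ⟨r, hr⟩ := Nat.gcd_dvd_right (Nat.card G) n
      obtain ⟨c, hc⟩ := Nat.gcd_dvd_left (Nat.card G) n
      have hpos : 0 < (Nat.card G).gcd n := Nat.gcd_pos_of_pos_left _ Nat.card_pos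
      refine ⟨r, ?_⟩
      have h1 : Nat.card G / (Nat.card G).gcd n = c := Nat.div_eq_of_eq_mul_right hpos hc
      rw [h1]
      conv_lhs => rw [hr]
      conv_rhs => rw [hc]
      ring
    obtain ⟨r, hr⟩ := this
    rw [hr, pow_mul, pow_card_eq_one', one_pow]
  have heq := Subgroup.eq_of_le_of_card_ge hle (by
    rw [IsCyclic.card_powMonoidHom_range, IsCyclic.card_powMonoidHom_ker]
    rw [Nat.gcd_eq_right (Nat.div_dvd_of_dvd (Nat.gcd_dvd_left _ _))])
  have hy : y ∈ (powMonoidHom n : G →* G).range := by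
    rw [heq]; exact h
  obtain ⟨x, hx⟩ := hy
  exact ⟨x, hx⟩

lemma card_fib {G : Type*} [CommGroup G] [DecidableEq G] [IsCyclic G] [Fintype G] (n : ℕ) (y : G)
    (h : ∃ x : G, x ^ n = y) :
    (Finset.univ.filter (fun x : G => x ^ n = y)).card = (Nat.card G).gcd n := by
  classical
  rw [← IsCyclic.card_powMonoidHom_ker, Nat.card_eq_fintype_card]
  have := MonoidHom.card_fiber_eq_of_mem_range (powMonoidHom n : G →* G) (x := y) (y := 1) h
    ⟨1, by simp⟩
  simp only [powMonoidHom_apply] at this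
  rw [this, Fintype.card_subtype]
  congr 1
  ext x
  simp [MonoidHom.mem_ker]

open Classical in
lemma card_rad (s j k : ℕ) (hk : 0 < k) (hj : Nat.Coprime j (4 * k)) (hs : 0 < s)
    (hp2 : p ≠ 2)
    (hc : Nat.card Kˣ = p ^ (4 * k * s) - 1) :
    (Finset.univ.filter (fun w : K => LL p (s * j) w = 0)).card = p ^ (2 * s) := by
  have hp1 : 1 < p := (Fact.out : p.Prime).one_lt
  have hposd : 0 < p ^ (2 * s) - 1 := by
    have := Nat.one_lt_pow (n := 2 * s) (by omega) hp1
    omega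
  have hpl : 1 ≤ p ^ (2 * (s * j)) := Nat.one_le_pow _ _ hp1.le
  have hex : ∃ x : Kˣ, x ^ (p ^ (2 * (s * j)) - 1) = -1 := by
    apply exists_root
    rw [hc, gcd_rad p s j k hj]
    apply Even.neg_one_pow
    have h1 : p ^ (2 * s) + 1 ∣ (p ^ (4 * k * s) - 1) / (p ^ (2 * s) - 1) := by
      rw [Nat.dvd_div_iff_mul_dvd]
      · have : (p ^ (2 * s) - 1) * (p ^ (2 * s) + 1) = p ^ (4 * s) - 1 := by
          rw [mul_comm, ← Nat.sq_sub_sq, one_pow, ← pow_mul]; ring_nf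
        rw [this, show 4 * k * s = 4 * s * k by ring, pow_mul p (4 * s)]
        exact Nat.sub_one_dvd_pow_sub_one _ _
      · rw [show 4 * k * s = 2 * s * (2 * k) by ring, pow_mul p (2 * s)]
        exact Nat.sub_one_dvd_pow_sub_one _ _
    have h2 : Even (p ^ (2 * s) + 1) := by
      have := ((Fact.out : p.Prime).odd_of_ne_two hp2).pow (n := 2 * s)
      exact this.add_one
    exact even_iff_two_dvd.2 (h2.two_dvd.trans h1)
  have hcf := card_fib _ _ hex
  rw [hc, gcd_rad p s j k hj] at hcf
  have hsplit : Finset.univ.filter (fun w : K => LL p (s * j) w = 0) =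
      insert 0 ((Finset.univ.filter
        (fun x : Kˣ => x ^ (p ^ (2 * (s * j)) - 1) = -1)).map ⟨Units.val, Units.val_injective⟩) := by
    ext w
    simp only [Finset.mem_filter, Finset.mem_univ, true_and, Finset.mem_insert, Finset.mem_map,
      Function.Embedding.coeFn_mk]
    have hw : p ^ (2 * (s * j)) = (p ^ (2 * (s * j)) - 1) + 1 := by omega
    constructor
    · intro h
      by_cases h0 : w = 0
      · exact Or.inl h0
      · right
        refine ⟨Units.mk0 w h0, ?_, rfl⟩
        rw [LL_apply, hw, pow_succ] at h
        ext
        simp only [Units.val_pow_eq_pow_val, Units.val_mk0, Units.val_neg, Units.val_one]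
        apply mul_right_cancel₀ h0
        linear_combination h
    · rintro (h | ⟨x, hx, rfl⟩)
      · rw [h, map_zero]
      · rw [LL_apply, hw, pow_succ]
        have := congrArg Units.val hx
        simp only [Units.val_pow_eq_pow_val, Units.val_neg, Units.val_one] at this
        rw [this]; ring
  rw [hsplit, Finset.card_insert_of_notMem, Finset.card_map, hcf]
  · omega
  · simp

open Classical in
lemma wS_sq (l : ℕ) (hp2 : p ≠ 2) :
    wS p l 1 (0 : K) * wS p l (-1) (0 : K) = (Fintype.card K : ℂ) *
      ((Finset.univ.filter (fun w : K => LL p l w = 0)).card : ℂ) := by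
  have h1 : wS p l 1 (0 : K) * wS p l (-1) (0 : K) =
      ∑ y : K, ∑ u : K, ZMod.stdAddChar (N := p) (Algebra.trace (ZMod p) K (u ^ (p ^ l + 1))) *
        chiK p K (y ^ p ^ l * LL p l u) := by
    rw [mul_comm]
    unfold wS
    rw [Finset.sum_mul]
    refine Finset.sum_congr rfl fun y _ => ?_
    rw [Finset.mul_sum, ← Equiv.sum_comp (Equiv.addLeft y)]
    refine Finset.sum_congr rfl fun u _ => ?_
    rw [chiK_apply, ← AddChar.map_add_eq_mul, ← AddChar.map_add_eq_mul]
    congr 1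
    simp only [Equiv.coe_addLeft, zero_mul, map_zero, add_zero]
    rw [trace_quad]; ring
  rw [h1, Finset.sum_comm]
  have h2 : ∀ u : K, ∑ y : K, ZMod.stdAddChar (N := p) (Algebra.trace (ZMod p) K (u ^ (p ^ l + 1))) *
        chiK p K (y ^ p ^ l * LL p l u) = if LL p l u = 0 then (Fintype.card K : ℂ) else 0 := by
    intro u
    rw [← Finset.mul_sum]
    have h3 : ∑ y : K, chiK p K (y ^ p ^ l * LL p l u) = ∑ y : K, chiK p K (y * LL p l u) := by
      have := charK p (K := K)
      rw [← Equiv.sum_comp (iterateFrobeniusEquiv K p l).toEquiv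
        (fun y => chiK p K (y * LL p l u))]
      refine Finset.sum_congr rfl fun y _ => ?_
      simp [iterateFrobeniusEquiv_apply, iterateFrobenius_def]
    rw [h3, AddChar.sum_mulShift _ (chiK_prim p K)]
    split_ifs with h
    · rw [trace_rad p l hp2 u h]; simp
    · simp
  rw [Finset.sum_congr rfl fun u _ => h2 u, ← Finset.sum_filter, Finset.sum_const, nsmul_eq_mul,
    mul_comm]

lemma wS_const (s j k : ℕ) (hj : Nat.Coprime j (4 * k))
    (hc : Nat.card Kˣ = p ^ (4 * k * s) - 1) (z : ZMod p) (hz : z ≠ 0) :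
    wS p (s * j) z (0 : K) = wS p (s * j) 1 (0 : K) := by
  have hz' : algebraMap (ZMod p) K z ≠ 0 := by simpa using hz
  obtain ⟨ν, hν⟩ : ∃ x : Kˣ, x ^ (p ^ (s * j) + 1) = Units.mk0 _ hz' := by
    apply exists_root
    rw [hc, gcd_quad p s j k hj]
    have h1 : p - 1 ∣ (p ^ (4 * k * s) - 1) / (p ^ s + 1) := by
      have hd : (p ^ s + 1) * (p ^ s - 1) ∣ p ^ (4 * k * s) - 1 := by
        rw [← Nat.sq_sub_sq, one_pow, ← pow_mul, show 4 * k * s = s * 2 * (2 * k) by ring,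
          pow_mul p (s * 2)]
        exact Nat.sub_one_dvd_pow_sub_one _ _
      rw [Nat.dvd_div_iff_mul_dvd]
      · exact (mul_dvd_mul_left _ (Nat.sub_one_dvd_pow_sub_one _ _)).trans hd
      · exact (Dvd.intro _ rfl).trans hd
    obtain ⟨r, hr⟩ := h1
    rw [hr]
    ext
    simp only [Units.val_pow_eq_pow_val, Units.val_mk0, Units.val_one]
    rw [← map_pow, pow_mul, ZMod.pow_card_sub_one_eq_one hz, one_pow, map_one]
  have hν' : (ν : K) ^ (p ^ (s * j) + 1) = algebraMap (ZMod p) K z := by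
    have := congrArg Units.val hν
    simpa using this
  unfold wS
  rw [← Equiv.sum_comp (Equiv.mulLeft₀ (ν : K) ν.ne_zero) (fun x => ZMod.stdAddChar (N := p)
    (1 * Algebra.trace (ZMod p) K (x ^ (p ^ (s * j) + 1)) + Algebra.trace (ZMod p) K (0 * x)))]
  refine Finset.sum_congr rfl fun x _ => ?_
  simp only [Equiv.mulLeft₀_apply, zero_mul, map_zero, add_zero, mul_pow, hν', trace_zmul, one_mul]

lemma stdAddChar_integral (x : ZMod p) : IsIntegral ℤ (ZMod.stdAddChar (N := p) x) := by
  refine IsIntegral.of_pow (n := p) (Fact.out : p.Prime).pos ?_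
  rw [← AddChar.map_nsmul_eq_pow]
  simp [isIntegral_one]

open Classical in
lemma wS_int (s j k : ℕ) (hj : Nat.Coprime j (4 * k))
    (hc : Nat.card Kˣ = p ^ (4 * k * s) - 1) :
    ∃ A : ℂ, IsIntegral ℤ A ∧ wS p (s * j) 1 (0 : K) = 1 + ((p : ℂ) ^ s + 1) * A := by
  set n := p ^ (s * j) + 1 with hn
  let f : K → ℂ := fun x => ZMod.stdAddChar (N := p) (Algebra.trace (ZMod p) K x)
  have h1 : wS p (s * j) 1 (0 : K) = 1 + ∑ u : Kˣ, f ((u ^ n : Kˣ) : K) := by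
    unfold wS
    rw [← Finset.add_sum_erase _ _ (Finset.mem_univ (0 : K))]
    congr 1
    · simp
    · symm
      refine Finset.sum_bij (fun u _ => (u : K)) ?_ ?_ ?_ ?_
      · intro u _; simp
      · intro u _ v _ h; exact Units.ext h
      · intro b hb
        exact ⟨Units.mk0 b (by simpa using hb), Finset.mem_univ _, rfl⟩
      · intro u _; simp [f, hn]
  refine ⟨∑ y ∈ Finset.univ.image (fun u : Kˣ => u ^ n), f (y : K), ?_, ?_⟩
  · exact IsIntegral.sum _ fun y _ => stdAddChar_integral p _
  · rw [h1, ← Finset.sum_fiberwise_of_maps_to (s := Finset.univ)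
      (t := Finset.univ.image (fun u : Kˣ => u ^ n)) (g := fun u : Kˣ => u ^ n)
      (fun u hu => Finset.mem_image_of_mem _ hu), Finset.mul_sum]
    congr 1
    refine Finset.sum_congr rfl fun y hy => ?_
    rw [Finset.sum_congr rfl (g := fun _ => f (y : K))
      (fun u hu => by rw [(Finset.mem_filter.1 hu).2])]
    obtain ⟨x, -, hx⟩ := Finset.mem_image.1 hy
    rw [Finset.sum_const, card_fib n y ⟨x, hx⟩, hc, hn, gcd_quad p s j k hj, nsmul_eq_mul]
    push_cast; ring

lemma wS_eval (s j k : ℕ) (hk : 0 < k) (hj : Nat.Coprime j (4 * k)) (hs : 0 < s)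
    (hp2 : p ≠ 2) (hq : Fintype.card K = p ^ (4 * k * s)) (z : ZMod p) (hz : z ≠ 0) :
    wS p (s * j) z (0 : K) = -(p : ℂ) ^ (2 * k * s + s) := by
  classical
  have hc : Nat.card Kˣ = p ^ (4 * k * s) - 1 := by
    rw [Nat.card_units, Nat.card_eq_fintype_card, hq]
  rw [wS_const p s j k hj hc z hz]
  have hsq := wS_sq p (K := K) (s * j) hp2
  rw [wS_const p s j k hj hc (-1) (by simp), card_rad p s j k hk hj hs hp2 hc, hq] at hsq
  obtain ⟨A, hA, hA'⟩ := wS_int p (K := K) s j k hj hc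
  have hsq' : wS p (s * j) 1 (0 : K) ^ 2 = ((p : ℂ) ^ (2 * k * s + s)) ^ 2 := by
    rw [sq, hsq]; push_cast; ring
  rcases sq_eq_sq_iff_eq_or_eq_neg.1 hsq' with h | h
  · exfalso
    rw [h] at hA'
    have hp0 : (0 : ℚ) < (p : ℚ) ^ s + 1 := by positivity
    have hp0' : ((p : ℂ) ^ s + 1) ≠ 0 := by exact_mod_cast hp0.ne'
    have hAq : A = algebraMap ℚ ℂ (((p : ℚ) ^ (2 * k * s + s) - 1) / ((p : ℚ) ^ s + 1)) := by
      simp only [eq_ratCast]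
      push_cast
      rw [eq_div_iff hp0']
      linear_combination -hA'
    rw [hAq, isIntegral_algebraMap_iff (algebraMap ℚ ℂ).injective] at hA
    obtain ⟨t, ht⟩ := IsIntegrallyClosed.isIntegral_iff.1 hA
    have ht' : (t : ℤ) * ((p : ℤ) ^ s + 1) = (p : ℤ) ^ (2 * k * s + s) - 1 := by
      have : (t : ℚ) * ((p : ℚ) ^ s + 1) = (p : ℚ) ^ (2 * k * s + s) - 1 := by
        rw [← eq_div_iff hp0.ne']; simpa using ht
      exact_mod_cast this
    have hd : ((p : ℤ) ^ s + 1) ∣ (p : ℤ) ^ (2 * k * s + s) + 1 := by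
      have hodd : Odd (2 * k + 1) := ⟨k, rfl⟩
      have := hodd.add_dvd_pow_add_pow ((p : ℤ) ^ s) 1
      rw [one_pow, ← pow_mul] at this
      rwa [show s * (2 * k + 1) = 2 * k * s + s by ring] at this
    have hd2 : ((p : ℤ) ^ s + 1) ∣ 2 := by
      have h3 : (2 : ℤ) = ((p : ℤ) ^ (2 * k * s + s) + 1) - t * ((p : ℤ) ^ s + 1) := by
        rw [ht']; ring
      rw [h3]
      exact dvd_sub hd (Dvd.intro_left _ rfl)
    have hle := Int.le_of_dvd (by norm_num) hd2
    have hp1 : (1 : ℤ) < (p : ℤ) ^ s := by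
      exact_mod_cast Nat.one_lt_pow hs.ne' (Fact.out : p.Prime).one_lt
    omega
  · exact h


lemma sum_compl (d : ZMod p) :
    ∑ z ∈ ({0}ᶜ : Finset (ZMod p)), ZMod.stdAddChar (N := p) (z * d) =
      (if d = 0 then (p : ℂ) else 0) - 1 := by
  have h := AddChar.sum_mulShift d (ZMod.isPrimitive_stdAddChar p)
  rw [← Finset.sum_compl_add_sum ({0} : Finset (ZMod p)), Finset.sum_singleton, zero_mul,
    AddChar.map_zero_eq_one, ZMod.card] at h
  rw [eq_sub_iff_add_eq, h]
  split_ifs <;> simp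

/-- The exponential sum over `F_p` for fixed `c`. -/
def FF (T b c : ZMod p) : ℂ :=
  ∑ z1 ∈ ({0}ᶜ : Finset (ZMod p)), ZMod.stdAddChar (N := p) (-z1) *
    ∑ z2 ∈ ({0}ᶜ : Finset (ZMod p)), ZMod.stdAddChar (N := p) (-(c * z2)) *
      ZMod.stdAddChar (N := p) (-(z1 * (b⁻¹ * z2 * z1⁻¹) ^ 2 * T))

lemma FF_neg (T b c : ZMod p) : FF p T b (-c) = FF p T b c := by
  unfold FF
  refine Finset.sum_congr rfl fun z1 _ => ?_
  congr 1
  refine Finset.sum_bij (fun z _ => -z) ?_ ?_ ?_ ?_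
  · intro z hz; simpa using hz
  · intro z _ w _ h; simpa using h
  · intro z hz; exact ⟨-z, by simpa using hz, by simp⟩
  · intro z _
    congr 2 <;> ring

lemma FF_sum (T b : ZMod p) :
    ∑ c ∈ ({0}ᶜ : Finset (ZMod p)), FF p T b c =
      ((p : ℂ) - 1) - p * ((({0}ᶜ : Finset (ZMod p)).filter
        (fun t => 1 + (b⁻¹ * t) ^ 2 * T = 0)).card : ℂ) := by
  have h1 : ∑ c ∈ ({0}ᶜ : Finset (ZMod p)), FF p T b c =
      ∑ z1 ∈ ({0}ᶜ : Finset (ZMod p)), ∑ t ∈ ({0}ᶜ : Finset (ZMod p)),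
        -ZMod.stdAddChar (N := p) (z1 * (-(1 + (b⁻¹ * t) ^ 2 * T))) := by
    unfold FF
    rw [Finset.sum_comm]
    refine Finset.sum_congr rfl fun z1 hz1 => ?_
    have hz1' : z1 ≠ 0 := by simpa using hz1
    rw [← Finset.mul_sum, Finset.sum_comm, Finset.mul_sum]
    refine Finset.sum_bij (fun z _ => z * z1⁻¹) ?_ ?_ ?_ ?_
    · intro z hz
      have hz' : z ≠ 0 := by simpa using hz
      simp [hz', hz1']
    · intro z _ w _ h
      exact mul_right_cancel₀ (inv_ne_zero hz1') h
    · intro z hz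
      have hz' : z ≠ 0 := by simpa using hz
      exact ⟨z * z1, by simp [hz', hz1'], by field_simp⟩
    · intro z hz
      have hz' : z ≠ 0 := by simpa using hz
      rw [← Finset.sum_mul]
      have h2 : ∑ c ∈ ({0}ᶜ : Finset (ZMod p)), ZMod.stdAddChar (N := p) (-(c * z)) = -1 := by
        have := sum_compl p (-z)
        rw [if_neg (neg_ne_zero.2 hz')] at this
        simpa using this
      rw [h2, neg_one_mul, mul_neg, ← AddChar.map_add_eq_mul]
      congr 2
      ring
  rw [h1, Finset.sum_comm]
  have h3 : ∀ t : ZMod p, ∑ z1 ∈ ({0}ᶜ : Finset (ZMod p)),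
        -ZMod.stdAddChar (N := p) (z1 * (-(1 + (b⁻¹ * t) ^ 2 * T))) =
      1 - (if 1 + (b⁻¹ * t) ^ 2 * T = 0 then (p : ℂ) else 0) := by
    intro t
    rw [Finset.sum_neg_distrib, sum_compl]
    simp only [neg_eq_zero]
    ring
  rw [Finset.sum_congr rfl fun t _ => h3 t, Finset.sum_sub_distrib, ← Finset.sum_filter,
    Finset.sum_const, Finset.sum_const, nsmul_eq_mul, nsmul_eq_mul]
  have h4 : (({0}ᶜ : Finset (ZMod p)).card : ℂ) = (p : ℂ) - 1 := by
    rw [Finset.card_compl, ZMod.card, Finset.card_singleton,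
      Nat.cast_sub (Fact.out : p.Prime).one_le, Nat.cast_one]
  rw [h4]; ring

lemma nsq_mul (hp : p % 4 = 3) (x : ZMod p) (hx : x ≠ 0) : IsSquare (-x) ↔ ¬ IsSquare x := by
  have hm1 : ¬ IsSquare (-1 : ZMod p) := by
    rw [ZMod.exists_sq_eq_neg_one_iff]; omega
  constructor
  · rintro h1 h2
    apply hm1
    have := h1.div h2
    rwa [neg_div, div_self hx] at this
  · intro h
    have h1 : quadraticChar (ZMod p) (-1) = -1 :=
      quadraticChar_neg_one_iff_not_isSquare.2 hm1
    have h2 : quadraticChar (ZMod p) x = -1 :=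
      quadraticChar_neg_one_iff_not_isSquare.2 h
    have h3 : quadraticChar (ZMod p) (-x) = 1 := by
      rw [← neg_one_mul, map_mul, h1, h2]; norm_num
    exact (quadraticChar_one_iff_isSquare (neg_ne_zero.2 hx)).1 h3

lemma mem_cyc0 (x : ZMod p) : x ∈ cyc p 0 ↔ x ≠ 0 ∧ IsSquare x := by
  simp [cyc]

lemma mem_cyc1 (x : ZMod p) : x ∈ cyc p 1 ↔ x ≠ 0 ∧ ¬ IsSquare x := by
  simp [cyc]

lemma cyc_half (hp : p % 4 = 3) (i : ℕ) (hi : i ≤ 1) (T b : ZMod p) :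
    ∑ c ∈ cyc p i, FF p T b c = (∑ c ∈ ({0}ᶜ : Finset (ZMod p)), FF p T b c) / 2 := by
  classical
  have h01 : ∑ c ∈ cyc p 0, FF p T b c = ∑ c ∈ cyc p 1, FF p T b c := by
    refine Finset.sum_bij (fun c _ => -c) ?_ ?_ ?_ ?_
    · intro c hc
      rw [mem_cyc0] at hc
      rw [mem_cyc1, ← nsq_mul p hp _ (neg_ne_zero.2 hc.1), neg_neg]
      exact ⟨neg_ne_zero.2 hc.1, hc.2⟩
    · intro z _ w _ h; simpa using h
    · intro c hc
      rw [mem_cyc1] at hc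
      refine ⟨-c, ?_, by simp⟩
      rw [mem_cyc0, nsq_mul p hp _ hc.1]
      exact ⟨neg_ne_zero.2 hc.1, hc.2⟩
    · intro c _; rw [FF_neg]
  have hU : ({0}ᶜ : Finset (ZMod p)) = cyc p 0 ∪ cyc p 1 := by
    ext c
    rw [Finset.mem_union, mem_cyc0, mem_cyc1]
    simp only [Finset.mem_compl, Finset.mem_singleton]
    tauto
  have hD : Disjoint (cyc p 0) (cyc p 1) := by
    rw [Finset.disjoint_left]
    intro c h0 h1
    rw [mem_cyc0] at h0
    rw [mem_cyc1] at h1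
    exact h1.2 h0.2
  rw [hU, Finset.sum_union hD]
  interval_cases i
  · rw [← h01]; ring
  · rw [h01]; ring

lemma count_zero (hp : p % 4 = 3) (T b : ZMod p) (hb : b ≠ 0) (hT : T = 0 ∨ T ∈ cyc p 0) :
    (({0}ᶜ : Finset (ZMod p)).filter (fun t => 1 + (b⁻¹ * t) ^ 2 * T = 0)).card = 0 := by
  rw [Finset.card_eq_zero, Finset.filter_eq_empty_iff]
  intro t _ h
  rcases hT with hT | hT
  · rw [hT] at h; simp at h
  · rw [mem_cyc0] at hT
    have hm1 : ¬ IsSquare (-1 : ZMod p) := by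
      rw [ZMod.exists_sq_eq_neg_one_iff]; omega
    apply hm1
    have : (-1 : ZMod p) = (b⁻¹ * t) ^ 2 * T := by linear_combination -h
    rw [this]
    exact (IsSquare.sq _).mul hT.2

lemma count_two (hp : p % 4 = 3) (T b : ZMod p) (hb : b ≠ 0) (hT : T ∈ cyc p 1) :
    (({0}ᶜ : Finset (ZMod p)).filter (fun t => 1 + (b⁻¹ * t) ^ 2 * T = 0)).card = 2 := by
  rw [mem_cyc1] at hT
  obtain ⟨r, hr⟩ := (nsq_mul p hp T hT.1).2 hT.2
  have hr0 : r ≠ 0 := by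
    rintro rfl
    apply hT.1
    linear_combination -hr
  have hT' : T = -(r * r) := by linear_combination -hr
  have h2 : (2 : ZMod p) ≠ 0 := by
    intro h
    have h2' : ((2 : ℕ) : ZMod p) = 0 := by exact_mod_cast h
    rw [ZMod.natCast_eq_zero_iff] at h2'
    have := Nat.le_of_dvd (by norm_num) h2'
    omega
  have hne : b * r⁻¹ ≠ -(b * r⁻¹) := by
    intro h
    have h3 : 2 * (b * r⁻¹) = 0 := by linear_combination h
    exact (mul_ne_zero h2 (mul_ne_zero hb (inv_ne_zero hr0))) h3
  have : (({0}ᶜ : Finset (ZMod p)).filter (fun t => 1 + (b⁻¹ * t) ^ 2 * T = 0)) =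
      {b * r⁻¹, -(b * r⁻¹)} := by
    ext t
    simp only [Finset.mem_filter, Finset.mem_compl, Finset.mem_singleton, Finset.mem_insert]
    constructor
    · rintro ⟨-, h⟩
      rw [hT'] at h
      have h4 : (b⁻¹ * t * r - 1) * (b⁻¹ * t * r + 1) = 0 := by linear_combination -h
      rcases mul_eq_zero.1 h4 with h5 | h5
      · left; field_simp at h5 ⊢; linear_combination h5
      · right; field_simp at h5 ⊢; linear_combination h5
    · rintro (rfl | rfl)
      · refine ⟨mul_ne_zero hb (inv_ne_zero hr0), ?_⟩
        rw [hT']; field_simp; ring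
      · refine ⟨neg_ne_zero.2 (mul_ne_zero hb (inv_ne_zero hr0)), ?_⟩
        rw [hT']; field_simp; ring
  rw [this, Finset.card_pair hne]

lemma zetaP_pow (x : ZMod p) : zetaP p ^ x.val = ZMod.stdAddChar (N := p) x := by
  have h := ZMod.stdAddChar_coe (N := p) (x.val : ℤ)
  have hx : (((x.val : ℕ) : ℤ) : ZMod p) = x := by simp
  rw [hx] at h
  rw [h, zetaP, ← Complex.exp_nat_mul]
  congr 1
  push_cast
  ring

lemma weilSum_eq (e l : ℕ) [Fintype (GaloisField p e)] (z : ZMod p) (β : GaloisField p e) :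
    weilSum p e l (algebraMap (ZMod p) (GaloisField p e) z) β = wS p l z β := by
  unfold weilSum wS
  simp only [zetaP_pow, tr, map_add, trace_zmul]
  refine Finset.sum_congr ?_ fun _ _ => rfl
  ext; simp

end helpers

/-- the value of `ψ_4^{(i)}(a, b)` for `a ≠ 0`, `b ∈ F_p^*`,
when `m/s` is even (paper Lemma 14). -/
theorem psi4_eval_even (p e l m s : ℕ) [Fact p.Prime] (hp : p % 4 = 3)
    (hl : 0 < l) (hm : 1 ≤ m) (he : e = 2 * m) (hs : s = Nat.gcd l e)
    (hsm : s ∣ m) (heven : Even (m / s)) (a : GaloisField p e) (ha : a ≠ 0)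
    (b : ZMod p) (hb : b ≠ 0) :
    ((¬ ∃ x : GaloisField p e, x ^ p ^ (2 * l) + x = -a ^ p ^ l) →
      ∀ i ≤ 1, psi4 p e l i a b = 0) ∧
    ∀ γ : GaloisField p e, γ ^ p ^ (2 * l) + γ = -a ^ p ^ l →
      ∀ i ≤ 1,
        ((tr p e (γ ^ (p ^ l + 1)) = 0 ∨ tr p e (γ ^ (p ^ l + 1)) ∈ cyc p 0) →
          psi4 p e l i a b = -(((p : ℂ) - 1) / 2) * (p : ℂ) ^ ((e : ℤ) + m + s - 3)) ∧
        (tr p e (γ ^ (p ^ l + 1)) ∈ cyc p 1 →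
          psi4 p e l i a b = ((p : ℂ) + 1) / 2 * (p : ℂ) ^ ((e : ℤ) + m + s - 3)) := by
  classical
  letI : Fintype (GaloisField p e) := Fintype.ofFinite _
  have hp2 : p ≠ 2 := by rintro rfl; omega
  have hsl : s ∣ l := hs ▸ Nat.gcd_dvd_left _ _
  have hs0 : 0 < s := Nat.pos_of_dvd_of_pos hsl hl
  obtain ⟨j, hj⟩ := hsl
  obtain ⟨r, hr⟩ := hsm
  rw [hr, Nat.mul_div_cancel_left _ hs0] at heven
  obtain ⟨k, hk⟩ := heven
  have hk0 : 0 < k := by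
    rcases Nat.eq_zero_or_pos k with h | h
    · subst h; subst hk; omega
    · exact h
  have hmk : m = 2 * k * s := by rw [hr, hk]; ring
  have he4 : e = 4 * k * s := by rw [he, hmk]; ring
  have hcop : Nat.Coprime j (4 * k) := by
    have h1 : s * Nat.gcd j (4 * k) = s * 1 := by
      rw [← Nat.gcd_mul_left, ← hj, mul_one]
      conv_rhs => rw [hs]
      rw [he4]; congr 1; ring
    exact Nat.eq_of_mul_eq_mul_left hs0 h1
  have he0 : e ≠ 0 := by omega
  have hcard : Fintype.card (GaloisField p e) = p ^ (4 * k * s) := by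
    rw [← Nat.card_eq_fintype_card, GaloisField.card p e he0, he4]
  have hpsi : ∀ i, psi4 p e l i a b = (p : ℂ) ^ ((e : ℤ) - 3) *
      ∑ c ∈ cyc p i, ∑ z1 ∈ ({0}ᶜ : Finset (ZMod p)), ZMod.stdAddChar (N := p) (-z1) *
      ∑ z2 ∈ ({0}ᶜ : Finset (ZMod p)), ZMod.stdAddChar (N := p) (-(c * z2)) *
        wS p l z1 (-a * algebraMap (ZMod p) (GaloisField p e) (z1 * (b⁻¹ * z2 * z1⁻¹))) := by
    intro i
    unfold psi4
    congr 1
    refine Finset.sum_congr rfl fun c _ => Finset.sum_congr rfl fun z1 hz1 => ?_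
    have hz1' : z1 ≠ 0 := by simpa using hz1
    rw [zetaP_pow]
    congr 1
    refine Finset.sum_congr rfl fun z2 _ => ?_
    rw [zetaP_pow, weilSum_eq]
    congr 4
    field_simp
  refine ⟨?_, ?_⟩
  · intro hno i _
    obtain ⟨w, hw, haw⟩ := exists_rad p l a hno
    rw [hpsi]
    refine mul_eq_zero_of_right _ (Finset.sum_eq_zero fun c _ => Finset.sum_eq_zero fun z1 hz1 =>
      mul_eq_zero_of_right _ (Finset.sum_eq_zero fun z2 hz2 => mul_eq_zero_of_right _ ?_))
    have hz1' : z1 ≠ 0 := by simpa using hz1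
    have hz2' : z2 ≠ 0 := by simpa using hz2
    exact wS_zero p l z1 _ a w hw (mul_ne_zero hz1' (mul_ne_zero (mul_ne_zero (inv_ne_zero hb) hz2')
      (inv_ne_zero hz1'))) hp2 haw
  · intro γ hγ i hi
    have hmain : psi4 p e l i a b = (p : ℂ) ^ ((e : ℤ) - 3) * (-(p : ℂ) ^ (m + s) *
        ∑ c ∈ cyc p i, FF p (tr p e (γ ^ (p ^ l + 1))) b c) := by
      rw [hpsi]
      congr 1
      rw [Finset.mul_sum]
      refine Finset.sum_congr rfl fun c _ => ?_
      unfold FF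
      rw [Finset.mul_sum]
      refine Finset.sum_congr rfl fun z1 hz1 => ?_
      have hz1' : z1 ≠ 0 := by simpa using hz1
      rw [mul_left_comm]
      congr 1
      rw [Finset.mul_sum]
      refine Finset.sum_congr rfl fun z2 _ => ?_
      rw [wS_shift p l z1 _ a γ hγ]
      have hev : wS p l z1 (0 : GaloisField p e) = -(p : ℂ) ^ (m + s) := by
        rw [hj, hmk]
        exact wS_eval p s j k hk0 hcop hs0 hp2 hcard z1 hz1'
      rw [hev, tr]
      ring
    have hp0 : (p : ℂ) ≠ 0 := by exact_mod_cast (Fact.out : p.Prime).ne_zero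
    have hpow : (p : ℂ) ^ ((e : ℤ) + m + s - 3) = (p : ℂ) ^ ((e : ℤ) - 3) * (p : ℂ) ^ (m + s) := by
      rw [← zpow_natCast, ← zpow_add₀ hp0]
      congr 1
      push_cast
      ring
    rw [hmain, cyc_half p hp i hi, FF_sum, hpow]
    constructor
    · intro hT
      rw [count_zero p hp _ b hb hT]
      push_cast; ring
    · intro hT
      rw [count_two p hp _ b hb hT]
      push_cast; ring

end
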